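/- arXiv:1608.04573 — 2 statements merged into one kernel-verified Lean document; each statement's English description precedes it below -/
import Mathlib

section
/- Let n ≥ 1 and a = (a₁,…,aₙ) ∈ [1,∞)ⁿ. The anisotropic distance function satisfies the triangle inequality: for all x, y ∈ ℝⁿ one has |x + y|_a ≤ |x|_a + |y|_a. -/
/-- The anisotropic distance function `|x|_a`: it is `0` at `x = 0`, and for `x ≠ 0` it is
the unique `t > 0` with `x₁²/t^{2a₁} + ⋯ + xₙ²/t^{2aₙ} = 1` (chosen via `Classical.epsilon`). -/
noncomputable def anisoNorm {n : ℕ} (a : Fin n → ℝ) (x : Fin n → ℝ) : ℝ :=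
  if x = 0 then 0
  else Classical.epsilon fun t : ℝ => 0 < t ∧ ∑ i, (x i) ^ 2 / t ^ (2 * a i) = 1

lemma exists_pos_sum_sq_div_rpow_eq_one {n : ℕ} {a : Fin n → ℝ} (ha : ∀ i, 1 ≤ a i)
    {x : Fin n → ℝ} (hx : x ≠ 0) :
    ∃ t : ℝ, 0 < t ∧ ∑ i, (x i) ^ 2 / t ^ (2 * a i) = 1 := by
  obtain ⟨j, hj⟩ := Function.ne_iff.mp hx
  have hj' : 0 < |x j| := abs_pos.mpr hj
  set r : ℝ := min 1 |x j|
  set R : ℝ := 1 + ∑ i, (x i) ^ 2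
  have hr : 0 < r := lt_min one_pos hj'
  have hR : 1 ≤ R := le_add_of_nonneg_right (Finset.sum_nonneg fun i _ => sq_nonneg _)
  have hcont : ContinuousOn (fun t : ℝ => ∑ i, (x i) ^ 2 / t ^ (2 * a i)) (Set.Icc r R) := by
    refine continuousOn_finsetSum _ fun i _ => ContinuousOn.div continuousOn_const ?_ ?_
    · exact continuousOn_id.rpow_const fun t ht => Or.inl (hr.trans_le ht.1).ne'
    · exact fun t ht => (Real.rpow_pos_of_pos (hr.trans_le ht.1) _).ne'
  have hlow : 1 ≤ ∑ i, (x i) ^ 2 / r ^ (2 * a i) := by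
    calc (1 : ℝ) ≤ (x j) ^ 2 / r ^ (2 * a j) := by
          rw [one_le_div (Real.rpow_pos_of_pos hr _)]
          calc r ^ (2 * a j) ≤ r ^ (2 : ℝ) :=
                Real.rpow_le_rpow_of_exponent_ge hr (min_le_left _ _) (by linarith [ha j])
            _ = r ^ 2 := Real.rpow_two r
            _ ≤ |x j| ^ 2 := by gcongr; exact min_le_right _ _
            _ = (x j) ^ 2 := sq_abs _
      _ ≤ _ := Finset.single_le_sum (f := fun i => (x i) ^ 2 / r ^ (2 * a i))
          (fun i _ => by positivity) (Finset.mem_univ j)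
  have hhigh : ∑ i, (x i) ^ 2 / R ^ (2 * a i) ≤ 1 := by
    calc ∑ i, (x i) ^ 2 / R ^ (2 * a i) ≤ ∑ i, (x i) ^ 2 / R := by
          gcongr with i
          exact Real.self_le_rpow_of_one_le hR (by linarith [ha i])
      _ = (∑ i, (x i) ^ 2) / R := (Finset.sum_div _ _ _).symm
      _ ≤ 1 := (div_le_one (by linarith)).mpr (le_add_of_nonneg_left zero_le_one)
  obtain ⟨t, ht, h⟩ :=
    intermediate_value_Icc' ((min_le_left _ _).trans hR) hcont ⟨hhigh, hlow⟩
  exact ⟨t, hr.trans_le ht.1, h⟩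

lemma anisoNorm_spec {n : ℕ} {a : Fin n → ℝ} (ha : ∀ i, 1 ≤ a i) {x : Fin n → ℝ} (hx : x ≠ 0) :
    0 < anisoNorm a x ∧ ∑ i, (x i) ^ 2 / anisoNorm a x ^ (2 * a i) = 1 := by
  rw [anisoNorm, if_neg hx]
  exact Classical.epsilon_spec (exists_pos_sum_sq_div_rpow_eq_one ha hx)

lemma anisoNorm_nonneg {n : ℕ} {a : Fin n → ℝ} (ha : ∀ i, 1 ≤ a i) (x : Fin n → ℝ) :
    0 ≤ anisoNorm a x := by
  by_cases hx : x = 0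
  · simp [anisoNorm, hx]
  · exact (anisoNorm_spec ha hx).1.le

lemma anisoNorm_le_of_sum_le_one {n : ℕ} {a : Fin n → ℝ} (ha : ∀ i, 1 ≤ a i) {x : Fin n → ℝ}
    {t : ℝ} (ht : 0 < t) (h : ∑ i, (x i) ^ 2 / t ^ (2 * a i) ≤ 1) : anisoNorm a x ≤ t := by
  by_cases hx : x = 0
  · simpa [anisoNorm, hx] using ht.le
  obtain ⟨-, h₁⟩ := anisoNorm_spec ha hx
  by_contra! hlt
  obtain ⟨j, hj⟩ := Function.ne_iff.mp hx
  have hpow (i : Fin n) : t ^ (2 * a i) < anisoNorm a x ^ (2 * a i) :=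
    Real.rpow_lt_rpow ht.le hlt (by linarith [ha i])
  have hpos (i : Fin n) : 0 < t ^ (2 * a i) := Real.rpow_pos_of_pos ht _
  refine (h₁ ▸ h).not_gt (Finset.sum_lt_sum (fun i _ => ?_) ⟨j, Finset.mem_univ j, ?_⟩)
  · exact div_le_div_of_nonneg_left (sq_nonneg _) (hpos i) (hpow i).le
  · exact div_lt_div_of_pos_left (sq_pos_of_ne_zero hj) (hpos j) (hpow j)

lemma rpow_le_div_mul_rpow_add {s r b : ℝ} (hs : 0 < s) (hr : 0 < r) (hb : 1 ≤ b) :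
    s ^ b ≤ s / (s + r) * (s + r) ^ b := by
  have hT : 0 < s + r := add_pos hs hr
  have h := Real.rpow_le_rpow_of_exponent_ge (div_pos hs hT)
    ((div_le_one hT).mpr (le_add_of_nonneg_right hr.le)) hb
  rwa [Real.rpow_one, Real.div_rpow hs.le hT.le, div_le_iff₀ (Real.rpow_pos_of_pos hT _)] at h

lemma add_sq_div_rpow_add_le {s r b : ℝ} (hs : 0 < s) (hr : 0 < r) (hb : 1 ≤ b) (p q : ℝ) :
    (p + q) ^ 2 / (s + r) ^ (2 * b) ≤
      s / (s + r) * (p ^ 2 / s ^ (2 * b)) + r / (s + r) * (q ^ 2 / r ^ (2 * b)) := by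
  have hT : 0 < s + r := add_pos hs hr
  have hsq {z : ℝ} (hz : 0 < z) : z ^ (2 * b) = (z ^ b) ^ 2 := by
    rw [mul_comm, Real.rpow_mul hz.le, Real.rpow_two]
  rw [hsq hT, hsq hs, hsq hr, ← div_pow, ← div_pow, ← div_pow]
  have hS := Real.rpow_pos_of_pos hs b
  have hR := Real.rpow_pos_of_pos hr b
  have hTb := Real.rpow_pos_of_pos hT b
  have hsum : s / (s + r) + r / (s + r) = 1 := by field_simp
  have hle : |(p + q) / (s + r) ^ b| ≤
      s / (s + r) * |p / s ^ b| + r / (s + r) * |q / r ^ b| := by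
    have hp : |p| ≤ s / (s + r) * |p / s ^ b| * (s + r) ^ b := by
      calc |p| = |p / s ^ b| * s ^ b := by
            rw [abs_div, abs_of_pos hS, div_mul_cancel₀ _ hS.ne']
        _ ≤ |p / s ^ b| * (s / (s + r) * (s + r) ^ b) := by
            gcongr
            exact rpow_le_div_mul_rpow_add hs hr hb
        _ = _ := by ring
    have hq : |q| ≤ r / (s + r) * |q / r ^ b| * (s + r) ^ b := by
      calc |q| = |q / r ^ b| * r ^ b := by
            rw [abs_div, abs_of_pos hR, div_mul_cancel₀ _ hR.ne']
        _ ≤ |q / r ^ b| * (r / (s + r) * (s + r) ^ b) := by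
            gcongr
            simpa only [add_comm r s] using rpow_le_div_mul_rpow_add hr hs hb
        _ = _ := by ring
    rw [abs_div, abs_of_pos hTb, div_le_iff₀ hTb, add_mul]
    exact (abs_add_le p q).trans (add_le_add hp hq)
  have hconv := (convexOn_pow 2).2 (abs_nonneg (p / s ^ b)) (abs_nonneg (q / r ^ b))
    (div_pos hs hT).le (div_pos hr hT).le hsum
  simp only [smul_eq_mul, sq_abs] at hconv
  calc ((p + q) / (s + r) ^ b) ^ 2 = |(p + q) / (s + r) ^ b| ^ 2 := (sq_abs _).symm
    _ ≤ (s / (s + r) * |p / s ^ b| + r / (s + r) * |q / r ^ b|) ^ 2 := by gcongr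
    _ ≤ _ := hconv

/-- the triangle inequality `|x + y|_a ≤ |x|_a + |y|_a`. -/
theorem statement2 {n : ℕ} (hn : 1 ≤ n) (a : Fin n → ℝ) (ha : ∀ i, 1 ≤ a i)
    (x y : Fin n → ℝ) :
    anisoNorm a (x + y) ≤ anisoNorm a x + anisoNorm a y := by
  by_cases hx : x = 0
  · simpa [hx] using anisoNorm_nonneg ha 0
  by_cases hy : y = 0
  · simpa [hy] using anisoNorm_nonneg ha 0
  obtain ⟨hs, hxs⟩ := anisoNorm_spec ha hx
  obtain ⟨hr, hyr⟩ := anisoNorm_spec ha hy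
  refine anisoNorm_le_of_sum_le_one ha (add_pos hs hr) ?_
  refine (Finset.sum_le_sum fun i _ =>
    add_sq_div_rpow_add_le hs hr (ha i) (x i) (y i)).trans_eq ?_
  rw [Finset.sum_add_distrib, ← Finset.mul_sum, ← Finset.mul_sum, hxs, hyr]
  field_simp
end

section
/- Let σ : ℝⁿ → ℝⁿ be a C^∞ bijection such that sup_{x∈ℝⁿ} |∂^α σ_j(x)| < ∞ for every j ∈ {1,…,n} and every multi-index α with |α| ≥ 1, and such that c_σ := inf_{x∈ℝⁿ} |det Jσ(x)| > 0. Then the inverse τ := σ⁻¹ is C^∞ and satisfies sup_{y∈ℝⁿ} |∂^α τ_j(y)| < ∞ for every j and every multi-index α with |α| ≥ 1; that is, σ is a bounded diffeomorphism. -/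
/-- The partial derivative `∂_i f` of a function on `ℝⁿ`. -/
noncomputable def pd {n : ℕ} {E : Type*} [NormedAddCommGroup E] [NormedSpace ℝ E]
    (i : Fin n) (f : (Fin n → ℝ) → E) : (Fin n → ℝ) → E :=
  fun x => fderiv ℝ f x (Pi.single i 1)

/-- The multi-index partial derivative `∂^α f = ∂₁^{α₁} ⋯ ∂ₙ^{αₙ} f`. -/
noncomputable def mderiv {n : ℕ} {E : Type*} [NormedAddCommGroup E] [NormedSpace ℝ E]
    (α : Fin n → ℕ) (f : (Fin n → ℝ) → E) : (Fin n → ℝ) → E :=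
  (List.finRange n).foldr (fun i g => (pd i)^[α i] g) f

/-- The Jacobian matrix `Jσ(x) = (∂_k σ_j(x))_{j,k}` of a map `σ : ℝⁿ → ℝⁿ`. -/
noncomputable def jacobian {n : ℕ} (σ : (Fin n → ℝ) → (Fin n → ℝ)) (x : Fin n → ℝ) :
    Matrix (Fin n) (Fin n) ℝ :=
  Matrix.of fun j k => pd k (fun y => σ y j) x

open scoped ContDiff

section PartialDerivatives

variable {n : ℕ}

theorem contDiff_pd {f : (Fin n → ℝ) → ℝ} (hf : ContDiff ℝ ∞ f) (i : Fin n) :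
    ContDiff ℝ ∞ (pd i f) :=
  (hf.fderiv_right (m := ∞) (by simp)).clm_apply contDiff_const

theorem pd_comm {f : (Fin n → ℝ) → ℝ} (hf : ContDiff ℝ ∞ f) (i j : Fin n) :
    pd i (pd j f) = pd j (pd i f) := by
  have key : ∀ (a b : Fin n) (x : Fin n → ℝ),
      pd a (pd b f) x = fderiv ℝ (fderiv ℝ f) x (Pi.single a 1) (Pi.single b 1) := by
    intro a b x
    have hd : DifferentiableAt ℝ (fderiv ℝ f) x :=
      (hf.fderiv_right (m := ∞) (by simp)).differentiable (by simp) x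
    have h := (hd.hasFDerivAt.clm_apply
      (hasFDerivAt_const (Pi.single b (1 : ℝ) : Fin n → ℝ) x)).fderiv
    change fderiv ℝ (fun y => fderiv ℝ f y (Pi.single b 1)) x (Pi.single a 1) = _
    rw [h]
    simp
  funext x
  rw [key, key]
  exact (hf.contDiffAt.isSymmSndFDerivAt
    (by simpa using WithTop.coe_le_coe.2 (le_top : (2 : ℕ∞) ≤ ⊤))).eq _ _

theorem contDiff_iterate_pd {f : (Fin n → ℝ) → ℝ} (hf : ContDiff ℝ ∞ f) (i : Fin n) (m : ℕ) :
    ContDiff ℝ ∞ ((pd i)^[m] f) := by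
  induction m with
  | zero => exact hf
  | succ m ih => rw [Function.iterate_succ_apply']; exact contDiff_pd ih i

theorem pd_iterate_pd {f : (Fin n → ℝ) → ℝ} (hf : ContDiff ℝ ∞ f) (i j : Fin n) (m : ℕ) :
    pd i ((pd j)^[m] f) = (pd j)^[m] (pd i f) := by
  induction m with
  | zero => rfl
  | succ m ih =>
    rw [Function.iterate_succ_apply', Function.iterate_succ_apply',
      pd_comm (contDiff_iterate_pd hf j m), ih]

theorem contDiff_foldr_pd {f : (Fin n → ℝ) → ℝ} (hf : ContDiff ℝ ∞ f) (α : Fin n → ℕ)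
    (l : List (Fin n)) : ContDiff ℝ ∞ (l.foldr (fun i g => (pd i)^[α i] g) f) := by
  induction l with
  | nil => exact hf
  | cons a l ih => exact contDiff_iterate_pd ih a _

theorem contDiff_mderiv {f : (Fin n → ℝ) → ℝ} (hf : ContDiff ℝ ∞ f) (α : Fin n → ℕ) :
    ContDiff ℝ ∞ (mderiv α f) :=
  contDiff_foldr_pd hf α _

theorem foldr_pd_add_single_of_notMem (f : (Fin n → ℝ) → ℝ) (α : Fin n → ℕ) (i : Fin n)
    {l : List (Fin n)} (hi : i ∉ l) :
    l.foldr (fun j g => (pd j)^[(α + Pi.single i 1 : Fin n → ℕ) j] g) f =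
      l.foldr (fun j g => (pd j)^[α j] g) f := by
  induction l with
  | nil => rfl
  | cons a l ih =>
    rw [List.mem_cons, not_or] at hi
    simp only [List.foldr_cons]
    rw [ih hi.2]
    simp [Pi.single_eq_of_ne (Ne.symm hi.1)]

theorem pd_foldr_pd {f : (Fin n → ℝ) → ℝ} (hf : ContDiff ℝ ∞ f) (α : Fin n → ℕ) (i : Fin n)
    {l : List (Fin n)} (hl : l.Nodup) (hi : i ∈ l) :
    pd i (l.foldr (fun j g => (pd j)^[α j] g) f) =
      l.foldr (fun j g => (pd j)^[(α + Pi.single i 1 : Fin n → ℕ) j] g) f := by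
  induction l with
  | nil => simp at hi
  | cons a l ih =>
    obtain ⟨ha, hl⟩ := List.nodup_cons.1 hl
    simp only [List.foldr_cons]
    by_cases hia : i = a
    · subst hia
      rw [foldr_pd_add_single_of_notMem f α i ha, Pi.add_apply, Pi.single_eq_same,
        Function.iterate_succ_apply']
    · rw [← ih hl ((List.mem_cons.1 hi).resolve_left hia),
        pd_iterate_pd (contDiff_foldr_pd hf α l)]
      simp [Pi.single_eq_of_ne (Ne.symm hia)]

theorem pd_mderiv {f : (Fin n → ℝ) → ℝ} (hf : ContDiff ℝ ∞ f) (α : Fin n → ℕ) (i : Fin n) :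
    pd i (mderiv α f) = mderiv (α + Pi.single i 1) f :=
  pd_foldr_pd hf α i (List.nodup_finRange n) (List.mem_finRange i)

theorem pd_const (i : Fin n) (c : ℝ) : pd i (fun _ : Fin n → ℝ => c) = fun _ => 0 := by
  funext x
  simp [pd]

theorem pd_add {f g : (Fin n → ℝ) → ℝ} (hf : ContDiff ℝ ∞ f) (hg : ContDiff ℝ ∞ g) (i : Fin n) :
    pd i (fun x => f x + g x) = fun x => pd i f x + pd i g x := by
  funext x
  simp only [pd]
  rw [fderiv_fun_add (hf.differentiable (by simp) x) (hg.differentiable (by simp) x)]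
  rfl

theorem pd_mul {f g : (Fin n → ℝ) → ℝ} (hf : ContDiff ℝ ∞ f) (hg : ContDiff ℝ ∞ g) (i : Fin n) :
    pd i (fun x => f x * g x) = fun x => f x * pd i g x + pd i f x * g x := by
  funext x
  simp only [pd]
  rw [fderiv_fun_mul (hf.differentiable (by simp) x) (hg.differentiable (by simp) x)]
  simp [mul_comm]

theorem pd_inv {f : (Fin n → ℝ) → ℝ} (hf : ContDiff ℝ ∞ f) (h0 : ∀ x, f x ≠ 0) (i : Fin n) :
    pd i (fun x => (f x)⁻¹) = fun x => (-1) * ((f x)⁻¹ * (f x)⁻¹ * pd i f x) := by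
  funext x
  have h := (hasDerivAt_inv (h0 x)).comp_hasFDerivAt x
    (hf.differentiable (by simp) x).hasFDerivAt
  change fderiv ℝ (Inv.inv ∘ f) x _ = _
  rw [h.fderiv]
  simp [pd, sq]

/-- The coordinates of the derivative are the derivatives of the coordinates. -/
theorem pd_apply {g : (Fin n → ℝ) → (Fin n → ℝ)} (hg : ContDiff ℝ ∞ g) (i j : Fin n)
    (x : Fin n → ℝ) : pd i (fun z => g z j) x = fderiv ℝ g x (Pi.single i 1) j := by
  have h := (hasFDerivAt_pi'.1 (hg.differentiable (by simp) x).hasFDerivAt j).fderiv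
  rw [pd, h]
  rfl

/-- The chain rule in coordinates. -/
theorem pd_comp {f : (Fin n → ℝ) → ℝ} {g : (Fin n → ℝ) → (Fin n → ℝ)} (hf : ContDiff ℝ ∞ f)
    (hg : ContDiff ℝ ∞ g) (i : Fin n) :
    pd i (fun x => f (g x)) = fun x => ∑ j, pd j f (g x) * pd i (fun z => g z j) x := by
  funext x
  have h := ((hf.differentiable (by simp) (g x)).hasFDerivAt.comp x
    (hg.differentiable (by simp) x).hasFDerivAt).fderiv
  change fderiv ℝ (f ∘ g) x _ = _
  rw [h, ContinuousLinearMap.comp_apply]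
  conv_lhs => rw [pi_eq_sum_univ' (fderiv ℝ g x (Pi.single i 1)), map_sum]
  refine Finset.sum_congr rfl fun j _ => ?_
  rw [pd_apply hg, map_smul, smul_eq_mul, mul_comm]
  congr 2

/-- `f` is smooth and all its partial derivatives of order at most `k` are bounded. -/
def BddDeriv : ℕ → ((Fin n → ℝ) → ℝ) → Prop
  | 0, f => ContDiff ℝ ∞ f ∧ ∃ M : ℝ, ∀ x, |f x| ≤ M
  | k + 1, f => (ContDiff ℝ ∞ f ∧ ∃ M : ℝ, ∀ x, |f x| ≤ M) ∧ ∀ i, BddDeriv k (pd i f)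

namespace BddDeriv

variable {k : ℕ} {f g : (Fin n → ℝ) → ℝ}

theorem contDiff (h : BddDeriv k f) : ContDiff ℝ ∞ f := by
  cases k with
  | zero => exact h.1
  | succ k => exact h.1.1

theorem bounded (h : BddDeriv k f) : ∃ M : ℝ, ∀ x, |f x| ≤ M := by
  cases k with
  | zero => exact h.2
  | succ k => exact h.1.2

theorem of_succ (h : BddDeriv (k + 1) f) : BddDeriv k f := by
  induction k generalizing f with
  | zero => exact h.1
  | succ k ih => exact ⟨h.1, fun i => ih (h.2 i)⟩

theorem const (k : ℕ) (c : ℝ) : BddDeriv k (fun _ : Fin n → ℝ => c) := by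
  induction k generalizing c with
  | zero => exact ⟨contDiff_const, |c|, fun _ => le_rfl⟩
  | succ k ih =>
    refine ⟨⟨contDiff_const, |c|, fun _ => le_rfl⟩, fun i => ?_⟩
    rw [pd_const]
    exact ih 0

theorem add (hf : BddDeriv k f) (hg : BddDeriv k g) : BddDeriv k (fun x => f x + g x) := by
  have base {k : ℕ} {f g : (Fin n → ℝ) → ℝ} (hf : BddDeriv k f) (hg : BddDeriv k g) :
      ContDiff ℝ ∞ (fun x => f x + g x) ∧ ∃ M : ℝ, ∀ x, |f x + g x| ≤ M := by
    obtain ⟨M, hM⟩ := hf.bounded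
    obtain ⟨N, hN⟩ := hg.bounded
    exact ⟨hf.contDiff.add hg.contDiff, M + N, fun x =>
      (abs_add_le _ _).trans (add_le_add (hM x) (hN x))⟩
  induction k generalizing f g with
  | zero => exact base hf hg
  | succ k ih =>
    refine ⟨base hf hg, fun i => ?_⟩
    rw [pd_add hf.contDiff hg.contDiff]
    exact ih (hf.2 i) (hg.2 i)

theorem mul (hf : BddDeriv k f) (hg : BddDeriv k g) : BddDeriv k (fun x => f x * g x) := by
  have base {k : ℕ} {f g : (Fin n → ℝ) → ℝ} (hf : BddDeriv k f) (hg : BddDeriv k g) :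
      ContDiff ℝ ∞ (fun x => f x * g x) ∧ ∃ M : ℝ, ∀ x, |f x * g x| ≤ M := by
    obtain ⟨M, hM⟩ := hf.bounded
    obtain ⟨N, hN⟩ := hg.bounded
    refine ⟨hf.contDiff.mul hg.contDiff, M * N, fun x => ?_⟩
    rw [abs_mul]
    exact mul_le_mul (hM x) (hN x) (abs_nonneg _) ((abs_nonneg _).trans (hM x))
  induction k generalizing f g with
  | zero => exact base hf hg
  | succ k ih =>
    refine ⟨base hf hg, fun i => ?_⟩
    rw [pd_mul hf.contDiff hg.contDiff]
    exact (ih hf.of_succ (hg.2 i)).add (ih (hf.2 i) hg.of_succ)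

theorem sum {ι : Type*} (s : Finset ι) {F : ι → (Fin n → ℝ) → ℝ}
    (h : ∀ a ∈ s, BddDeriv k (F a)) : BddDeriv k (fun x => ∑ a ∈ s, F a x) := by
  classical
  induction s using Finset.induction_on with
  | empty => simpa using const k 0
  | insert a s ha ih =>
    simp only [Finset.sum_insert ha]
    exact (h a (by simp)).add (ih fun b hb => h b (by simp [hb]))

theorem prod {ι : Type*} (s : Finset ι) {F : ι → (Fin n → ℝ) → ℝ}
    (h : ∀ a ∈ s, BddDeriv k (F a)) : BddDeriv k (fun x => ∏ a ∈ s, F a x) := by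
  classical
  induction s using Finset.induction_on with
  | empty => simpa using const k 1
  | insert a s ha ih =>
    simp only [Finset.prod_insert ha]
    exact (h a (by simp)).mul (ih fun b hb => h b (by simp [hb]))

theorem det {ι : Type*} [Fintype ι] [DecidableEq ι] {A : (Fin n → ℝ) → Matrix ι ι ℝ}
    (h : ∀ a b, BddDeriv k (fun x => A x a b)) : BddDeriv k (fun x => (A x).det) := by
  simp only [Matrix.det_apply']
  exact sum _ fun p _ => (const k _).mul (prod _ fun a _ => h _ _)

theorem adjugate {ι : Type*} [Fintype ι] [DecidableEq ι] {A : (Fin n → ℝ) → Matrix ι ι ℝ}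
    (h : ∀ a b, BddDeriv k (fun x => A x a b)) (a b : ι) :
    BddDeriv k (fun x => (A x).adjugate a b) := by
  simp only [Matrix.adjugate_apply]
  refine det fun i j => ?_
  by_cases hi : i = b
  · subst hi
    simpa using const k _
  · simpa [Matrix.updateRow_ne hi] using h i j

theorem inv (hf : BddDeriv k f) {c : ℝ} (hc : 0 < c) (h : ∀ x, c ≤ |f x|) :
    BddDeriv k (fun x => (f x)⁻¹) := by
  have h0 : ∀ x, f x ≠ 0 := fun x => abs_pos.1 (hc.trans_le (h x))
  have base : ContDiff ℝ ∞ (fun x => (f x)⁻¹) ∧ ∃ M : ℝ, ∀ x, |(f x)⁻¹| ≤ M := by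
    refine ⟨hf.contDiff.inv h0, c⁻¹, fun x => ?_⟩
    rw [abs_inv]
    exact inv_anti₀ hc (h x)
  induction k with
  | zero => exact base
  | succ k ih =>
    refine ⟨base, fun i => ?_⟩
    rw [pd_inv hf.contDiff h0]
    have := ih hf.of_succ
    exact (const k (-1)).mul ((this.mul this).mul (hf.2 i))

theorem comp {t : (Fin n → ℝ) → (Fin n → ℝ)} (ht : ContDiff ℝ ∞ t)
    (hf : BddDeriv (k + 1) f) (h : ∀ i j, BddDeriv k (pd i fun z => t z j)) :
    BddDeriv (k + 1) (fun x => f (t x)) := by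
  have base {k : ℕ} {f : (Fin n → ℝ) → ℝ} (hf : BddDeriv k f) :
      ContDiff ℝ ∞ (fun x => f (t x)) ∧ ∃ M : ℝ, ∀ x, |f (t x)| ≤ M :=
    ⟨hf.contDiff.comp ht, hf.bounded.imp fun M hM x => hM (t x)⟩
  induction k generalizing f with
  | zero =>
    refine ⟨base hf, fun i => ?_⟩
    rw [pd_comp hf.contDiff ht]
    exact sum _ fun j _ => mul (k := 0) (base (hf.2 j)) (h i j)
  | succ k ih =>
    refine ⟨base hf, fun i => ?_⟩
    rw [pd_comp hf.contDiff ht]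
    exact sum _ fun j _ => (ih (hf.2 j) fun i j => (h i j).of_succ).mul (h i j)

end BddDeriv

theorem bddDeriv_mderiv {f : (Fin n → ℝ) → ℝ} (hf : ContDiff ℝ ∞ f)
    (h : ∀ α : Fin n → ℕ, 1 ≤ ∑ i, α i → ∃ M : ℝ, ∀ x, |mderiv α f x| ≤ M) (k : ℕ)
    (α : Fin n → ℕ) (hα : 1 ≤ ∑ i, α i) : BddDeriv k (mderiv α f) := by
  induction k generalizing α with
  | zero => exact ⟨contDiff_mderiv hf α, h α hα⟩
  | succ k ih =>
    refine ⟨⟨contDiff_mderiv hf α, h α hα⟩, fun i => ?_⟩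
    rw [pd_mderiv hf]
    refine ih _ ?_
    simp only [Pi.add_apply, Finset.sum_add_distrib]
    omega

theorem mderiv_zero (f : (Fin n → ℝ) → ℝ) : mderiv 0 f = f := by
  simp [mderiv]

theorem exists_eq_add_single (α : Fin n → ℕ) (hα : 1 ≤ ∑ i, α i) :
    ∃ (γ : Fin n → ℕ) (i : Fin n), α = γ + Pi.single i 1 := by
  obtain ⟨i, -, hi⟩ := Finset.exists_ne_zero_of_sum_ne_zero (Nat.one_le_iff_ne_zero.1 hα)
  refine ⟨α - Pi.single i 1, i, (tsub_add_cancel_of_le fun j => ?_).symm⟩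
  by_cases hj : j = i
  · subst hj
    simpa using Nat.one_le_iff_ne_zero.2 hi
  · simp [Pi.single_eq_of_ne hj]

/-- All derivatives of positive order of `f` are bounded if all derivatives of the first-order
partial derivatives of `f` are. -/
theorem bounded_mderiv {f : (Fin n → ℝ) → ℝ} (hf : ContDiff ℝ ∞ f)
    (h : ∀ (k : ℕ) (i : Fin n), BddDeriv k (pd i f)) (α : Fin n → ℕ) (hα : 1 ≤ ∑ i, α i) :
    ∃ M : ℝ, ∀ x, |mderiv α f x| ≤ M := by
  have key : ∀ (m : ℕ) (β : Fin n → ℕ), ∑ i, β i = m → ∀ k i,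
      BddDeriv k (pd i (mderiv β f)) := by
    intro m
    induction m with
    | zero =>
      intro β hβ k i
      have hβ0 : β = 0 := funext fun a => Finset.sum_eq_zero_iff.1 hβ a (Finset.mem_univ a)
      rw [hβ0, mderiv_zero]
      exact h k i
    | succ m ih =>
      intro β hβ k i
      obtain ⟨γ, j, rfl⟩ := exists_eq_add_single β (by omega)
      rw [← pd_mderiv hf]
      refine (ih γ ?_ (k + 1) j).2 i
      simpa [Finset.sum_add_distrib] using hβ
  obtain ⟨γ, j, rfl⟩ := exists_eq_add_single α hα
  rw [← pd_mderiv hf]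
  exact (key _ γ rfl 0 j).bounded

theorem jacobian_eq_toMatrix' {g : (Fin n → ℝ) → (Fin n → ℝ)} (hg : ContDiff ℝ ∞ g)
    (x : Fin n → ℝ) :
    jacobian g x = LinearMap.toMatrix' (fderiv ℝ g x : (Fin n → ℝ) →ₗ[ℝ] (Fin n → ℝ)) := by
  ext j k
  simp [jacobian, pd_apply hg, LinearMap.toMatrix'_apply]

theorem contDiff_of_inverse {s t : (Fin n → ℝ) → (Fin n → ℝ)} (hs : ContDiff ℝ ∞ s)
    (h₁ : Function.LeftInverse t s) (h₂ : Function.RightInverse t s)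
    (hdet : ∀ x, (jacobian s x).det ≠ 0) : ContDiff ℝ ∞ t := by
  have hd : ∀ x, (fderiv ℝ s x).det ≠ 0 := fun x => by
    have := hdet x
    rwa [jacobian_eq_toMatrix' hs, LinearMap.det_toMatrix'] at this
  have hopen : IsOpenMap s := isOpenMap_of_hasStrictFDerivAt_equiv
    (f' := fun x => (fderiv ℝ s x).toContinuousLinearEquivOfDetNeZero (hd x)) fun x => by
      simpa using hs.contDiffAt.hasStrictFDerivAt (by simp)
  let e : (Fin n → ℝ) ≃ₜ (Fin n → ℝ) :=
    (Equiv.mk s t h₁ h₂).toHomeomorphOfContinuousOpen hs.continuous hopen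
  exact e.contDiff_symm
    (f₀' := fun x => (fderiv ℝ s x).toContinuousLinearEquivOfDetNeZero (hd x))
    (fun x => (hs.differentiable (by simp) x).hasFDerivAt) hs

/-- `Jτ(y) = (det Jσ(τ(y)))⁻¹ · Adj Jσ(τ(y))` for a right inverse `τ` of `σ`. -/
theorem jacobian_of_rightInverse {s t : (Fin n → ℝ) → (Fin n → ℝ)} (hs : ContDiff ℝ ∞ s)
    (ht : ContDiff ℝ ∞ t) (h : Function.RightInverse t s) (y : Fin n → ℝ) :
    jacobian t y = ((jacobian s (t y)).det)⁻¹ • (jacobian s (t y)).adjugate := by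
  have hmul : jacobian s (t y) * jacobian t y = 1 := by
    ext a b
    have hs' : ContDiff ℝ ∞ fun z => s z a := contDiff_pi.1 hs a
    have hc := congrFun (pd_comp hs' ht b) y
    have hid : (fun x => s (t x) a) = fun x => x a := funext fun x => by rw [h x]
    rw [hid, pd_apply (g := fun z => z) contDiff_id, fderiv_fun_id] at hc
    simp only [Matrix.mul_apply, jacobian, Matrix.of_apply]
    rw [← hc]
    simp [Matrix.one_apply, Pi.single_apply]
  rw [← Ring.inverse_eq_inv', ← Matrix.inv_def]
  exact (Matrix.inv_eq_right_inv hmul).symm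

end PartialDerivatives

/-- a `C^∞` bijection `σ : ℝⁿ → ℝⁿ` with all partial derivatives of order
`≥ 1` bounded and `inf_x |det Jσ(x)| ≥ c_σ > 0` has a `C^∞` inverse `τ` with all partial
derivatives of order `≥ 1` bounded; i.e. `σ` is a bounded diffeomorphism. -/
theorem statement11 {n : ℕ} (σ τ : (Fin n → ℝ) → (Fin n → ℝ))
    (hσ : ContDiff ℝ (⊤ : ℕ∞) σ)
    (hinv₁ : Function.LeftInverse τ σ) (hinv₂ : Function.RightInverse τ σ)
    (hbd : ∀ (j : Fin n) (α : Fin n → ℕ), 1 ≤ ∑ i, α i →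
      ∃ M : ℝ, ∀ x, |mderiv α (fun z => σ z j) x| ≤ M)
    (c : ℝ) (hc : 0 < c) (hdet : ∀ x, c ≤ |(jacobian σ x).det|) :
    ContDiff ℝ (⊤ : ℕ∞) τ ∧
      ∀ (j : Fin n) (α : Fin n → ℕ), 1 ≤ ∑ i, α i →
        ∃ M : ℝ, ∀ y, |mderiv α (fun z => τ z j) y| ≤ M := by
  have hdet0 : ∀ x, (jacobian σ x).det ≠ 0 := fun x => abs_pos.1 (hc.trans_le (hdet x))
  have hτ : ContDiff ℝ ∞ τ := contDiff_of_inverse hσ hinv₁ hinv₂ hdet0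
  have hJ : ∀ k a b, BddDeriv k (fun x => jacobian σ x a b) := by
    intro k a b
    have hσa : ContDiff ℝ ∞ fun z => σ z a := contDiff_pi.1 hσ a
    have h := bddDeriv_mderiv hσa (hbd a) k (0 + Pi.single b 1) (by simp)
    rwa [← pd_mderiv hσa, mderiv_zero] at h
  have hinv : ∀ k a b, BddDeriv k
      (fun x => ((jacobian σ x).det)⁻¹ * (jacobian σ x).adjugate a b) := fun k a b =>
    ((BddDeriv.det (hJ k)).inv hc hdet).mul (BddDeriv.adjugate (hJ k) a b)
  have hpd : ∀ i j, (pd i fun z => τ z j) =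
      fun y => ((jacobian σ (τ y)).det)⁻¹ * (jacobian σ (τ y)).adjugate j i := fun i j =>
    funext fun y => congrFun (congrFun (jacobian_of_rightInverse hσ hτ hinv₂ y) j) i
  have hτbd : ∀ k i j, BddDeriv k (pd i fun z => τ z j) := by
    intro k
    induction k with
    | zero =>
      intro i j
      refine ⟨contDiff_pd (contDiff_pi.1 hτ j) i, ?_⟩
      rw [hpd]
      exact (hinv 0 j i).bounded.imp fun M hM y => hM (τ y)
    | succ k ih =>
      intro i j
      rw [hpd]
      exact (hinv (k + 1) j i).comp hτ ih
  exact ⟨hτ, fun j => bounded_mderiv (contDiff_pi.1 hτ j) fun k i => hτbd k i j⟩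
end
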